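/- arXiv:1007.1366 — 2 statements merged into one kernel-verified Lean document; each statement's English description precedes it below -/
import Mathlib

section
/- For each n ≥ 2 let O^{(n)} be Haar distributed on the orthogonal group O(n) and set T^{(n)}_{p,q} = Σ_{i≤p, j≤q} (O^{(n)}_{ij})². Let p(n), q(n) be sequences in {1,…,n} with p(n)/n → s and q(n)/n → t for s, t ∈ [0,1]. Then (1/n) E[T^{(n)}_{p(n),q(n)}] → s t and Var(T^{(n)}_{p(n),q(n)}) → 2 s t (1−s)(1−t) as n → ∞. -/
open MeasureTheory Matrix ProbabilityTheory Filter

/-- The entrywise (Borel) measurable structure on matrices. -/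
instance matrixMeasurableSpace {m n α : Type*} [MeasurableSpace α] :
    MeasurableSpace (Matrix m n α) :=
  inferInstanceAs (MeasurableSpace (m → n → α))

/-- `T_{p,q} = Σ_{1 ≤ i ≤ p, 1 ≤ j ≤ q} O_{ij}²`. -/
noncomputable def truncTraceO (n p q : ℕ) (O : Matrix.orthogonalGroup (Fin n) ℝ) : ℝ :=
  ∑ i : Fin n, ∑ j : Fin n,
    if (i : ℕ) < p ∧ (j : ℕ) < q then ((O : Matrix (Fin n) (Fin n) ℝ) i j) ^ 2 else 0

/-- The value of an entry. -/
noncomputable def entO {n : ℕ} (O : Matrix.orthogonalGroup (Fin n) ℝ) (i j : Fin n) : ℝ :=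
  (O : Matrix (Fin n) (Fin n) ℝ) i j

lemma measurable_entO {n : ℕ} (i j : Fin n) :
    Measurable (fun O : Matrix.orthogonalGroup (Fin n) ℝ => entO O i j) := by
  have h1 : Measurable (fun M : Matrix (Fin n) (Fin n) ℝ => M i j) := by
    have : Measurable (fun M : Fin n → Fin n → ℝ => M i j) := by fun_prop
    exact this
  exact h1.comp measurable_subtype_coe

lemma entO_col {n : ℕ} (O : Matrix.orthogonalGroup (Fin n) ℝ) (j l : Fin n) :
    ∑ k, entO O k j * entO O k l = if j = l then 1 else 0 := by
  have h := (Matrix.mem_orthogonalGroup_iff' (Fin n) ℝ).1 O.2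
  have := congrFun (congrFun h j) l
  simpa [Matrix.mul_apply, Matrix.one_apply, entO, Matrix.star_eq_conjTranspose] using this

lemma entO_abs {n : ℕ} (O : Matrix.orthogonalGroup (Fin n) ℝ) (i j : Fin n) :
    |entO O i j| ≤ 1 := by
  have h := entO_col O j j
  simp only [if_true] at h
  have h2 : entO O i j * entO O i j ≤ ∑ k, entO O k j * entO O k j :=
    Finset.single_le_sum (f := fun k => entO O k j * entO O k j)
      (fun k _ => mul_self_nonneg _) (Finset.mem_univ i)
  rw [abs_le]
  constructor <;> nlinarith

/-- Householder reflection -/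
noncomputable def hhO {n : ℕ} (v : Fin n → ℝ) (c : ℝ) (hc : c ≠ 0) (hv : ∑ s, v s * v s = c) :
    Matrix.orthogonalGroup (Fin n) ℝ :=
  ⟨1 - (2 / c) • Matrix.vecMulVec v v, by
    rw [Matrix.mem_orthogonalGroup_iff']
    have h1 : (1 - (2 / c) • Matrix.vecMulVec v v).transpose = 1 - (2 / c) • Matrix.vecMulVec v v := by
      ext i j
      simp [Matrix.vecMulVec_apply, Matrix.one_apply, mul_comm,
        eq_comm]
    rw [h1]
    have h2 : Matrix.vecMulVec v v * Matrix.vecMulVec v v = c • Matrix.vecMulVec v v := by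
      ext i j
      simp only [Matrix.mul_apply, Matrix.vecMulVec_apply, Matrix.smul_apply, smul_eq_mul, ← hv,
        Finset.sum_mul]
      exact Finset.sum_congr rfl fun _ _ => by ring
    rw [sub_mul, mul_sub, mul_sub]
    simp only [one_mul, mul_one, Matrix.smul_mul, Matrix.mul_smul, h2, smul_smul]
    rw [show 2 / c * (2 / c * c) = 2 / c + 2 / c by field_simp; ring, add_smul]
    abel⟩

lemma entO_hh {n : ℕ} (v : Fin n → ℝ) (c : ℝ) (hc : c ≠ 0) (hv : ∑ s, v s * v s = c)
    (O : Matrix.orthogonalGroup (Fin n) ℝ) (r j : Fin n) :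
    entO (hhO v c hc hv * O) r j = entO O r j - 2 / c * v r * ∑ s, v s * entO O s j := by
  have h : ((hhO v c hc hv * O : Matrix.orthogonalGroup (Fin n) ℝ) : Matrix (Fin n) (Fin n) ℝ) =
      (1 - (2 / c) • Matrix.vecMulVec v v) * (O : Matrix (Fin n) (Fin n) ℝ) := rfl
  unfold entO
  rw [h, sub_mul, one_mul, Matrix.smul_mul, Matrix.sub_apply, Matrix.smul_apply, smul_eq_mul,
    Matrix.mul_apply, Finset.mul_sum, Finset.mul_sum]
  congr 1
  exact Finset.sum_congr rfl fun _ _ => by rw [Matrix.vecMulVec_apply]; ring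

lemma measurable_mulO {n : ℕ} (g : Matrix.orthogonalGroup (Fin n) ℝ) :
    Measurable (fun O : Matrix.orthogonalGroup (Fin n) ℝ => g * O) := by
  apply Measurable.subtype_mk
  have : Measurable (fun O : Matrix.orthogonalGroup (Fin n) ℝ =>
      (fun r j => ∑ s, entO g r s * entO O s j : Fin n → Fin n → ℝ)) := by
    refine measurable_pi_lambda _ fun r => measurable_pi_lambda _ fun j => ?_
    exact Finset.measurable_sum _ fun s _ => (measurable_entO s j).const_mul _
  exact this

lemma integral_hh {n : ℕ} (μ : Measure (Matrix.orthogonalGroup (Fin n) ℝ))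
    (hH : μ.IsHaarMeasure) (g : Matrix.orthogonalGroup (Fin n) ℝ)
    (f : Matrix.orthogonalGroup (Fin n) ℝ → ℝ) (hf : Measurable f) :
    ∫ O, f (g * O) ∂μ = ∫ O, f O ∂μ := by
  have h := MeasureTheory.map_mul_left_eq_self μ g
  conv_rhs => rw [← h]
  rw [integral_map (measurable_mulO g).aemeasurable hf.aestronglyMeasurable]

/-- fourth order moment -/
noncomputable def momO {n : ℕ} (μ : Measure (Matrix.orthogonalGroup (Fin n) ℝ))
    (j l r s t u : Fin n) : ℝ :=
  ∫ O, entO O r j * entO O s j * (entO O t l * entO O u l) ∂μ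

lemma meas4 {n : ℕ} (j l r s t u : Fin n) : Measurable
    (fun O : Matrix.orthogonalGroup (Fin n) ℝ =>
      entO O r j * entO O s j * (entO O t l * entO O u l)) :=
  ((measurable_entO _ _).mul (measurable_entO _ _)).mul
    ((measurable_entO _ _).mul (measurable_entO _ _))

lemma int4 {n : ℕ} (μ : Measure (Matrix.orthogonalGroup (Fin n) ℝ)) [IsProbabilityMeasure μ]
    (j l r s t u : Fin n) : Integrable
    (fun O : Matrix.orthogonalGroup (Fin n) ℝ =>
      entO O r j * entO O s j * (entO O t l * entO O u l)) μ := by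
  refine Integrable.of_bound (meas4 j l r s t u).aestronglyMeasurable 1 (ae_of_all _ fun O => ?_)
  rw [Real.norm_eq_abs, abs_mul, abs_mul, abs_mul]
  exact mul_le_one₀ (mul_le_one₀ (entO_abs O _ _) (abs_nonneg _) (entO_abs O _ _)) (by positivity)
    (mul_le_one₀ (entO_abs O _ _) (abs_nonneg _) (entO_abs O _ _))

lemma int2 {n : ℕ} (μ : Measure (Matrix.orthogonalGroup (Fin n) ℝ)) [IsProbabilityMeasure μ]
    (i j : Fin n) : Integrable
    (fun O : Matrix.orthogonalGroup (Fin n) ℝ => entO O i j * entO O i j) μ := by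
  refine Integrable.of_bound
    ((measurable_entO _ _).mul (measurable_entO _ _)).aestronglyMeasurable 1
    (ae_of_all _ fun O => ?_)
  rw [Real.norm_eq_abs, abs_mul]
  exact mul_le_one₀ (entO_abs O _ _) (abs_nonneg _) (entO_abs O _ _)

/-- swapping two rows -/
lemma exists_swapO {n : ℕ} (i k : Fin n) :
    ∃ g : Matrix.orthogonalGroup (Fin n) ℝ, ∀ O r j, entO (g * O) r j = entO O (Equiv.swap i k r) j := by
  by_cases hik : i = k
  · subst hik
    exact ⟨1, by simp⟩
  refine ⟨hhO (Pi.single i 1 - Pi.single k 1) 2 (by norm_num) ?_, fun O r j => ?_⟩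
  · simp [sub_mul, mul_sub, Pi.single_apply, Finset.sum_sub_distrib, hik, Ne.symm hik]
    norm_num
  · rw [entO_hh]
    simp only [Pi.sub_apply, sub_mul, Finset.sum_sub_distrib, Pi.single_apply, ite_mul, one_mul,
      zero_mul, Finset.sum_ite_eq', Finset.mem_univ, if_true]
    rcases eq_or_ne r i with rfl | h1
    · simp [hik]
    rcases eq_or_ne r k with rfl | h2
    · simp [Ne.symm hik]
    simp [h1, h2, Equiv.swap_apply_of_ne_of_ne]

lemma exists_flipO {n : ℕ} (i : Fin n) :
    ∃ g : Matrix.orthogonalGroup (Fin n) ℝ, ∀ O r j,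
      entO (g * O) r j = (if r = i then -1 else 1) * entO O r j := by
  refine ⟨hhO (Pi.single i 1) 1 (by norm_num) ?_, fun O r j => ?_⟩
  · simp [Pi.single_apply]
  · rw [entO_hh]
    simp only [Pi.single_apply, ite_mul, one_mul,
      zero_mul, Finset.sum_ite_eq', Finset.mem_univ, if_true]
    rcases eq_or_ne r i with rfl | h1
    · simp; ring
    simp [h1]

lemma exists_rotO {n : ℕ} (i k : Fin n) (hik : i ≠ k) :
    ∃ g : Matrix.orthogonalGroup (Fin n) ℝ, ∀ O j,
      entO (g * O) i j = 3 / 5 * entO O i j + 4 / 5 * entO O k j := by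
  refine ⟨hhO (Pi.single i 1 - Pi.single k 2) 5 (by norm_num) ?_, fun O j => ?_⟩
  · simp [sub_mul, mul_sub, Pi.single_apply, Finset.sum_sub_distrib, hik, Ne.symm hik]
    norm_num
  · rw [entO_hh]
    simp only [Pi.sub_apply, sub_mul, Finset.sum_sub_distrib, Pi.single_apply, ite_mul, one_mul,
      zero_mul, Finset.sum_ite_eq', Finset.mem_univ, if_true, hik, if_false]
    ring

lemma momO_swap {n : ℕ} (μ : Measure (Matrix.orthogonalGroup (Fin n) ℝ))
    (hH : μ.IsHaarMeasure) (i k j l r s t u : Fin n) :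
    momO μ j l (Equiv.swap i k r) (Equiv.swap i k s) (Equiv.swap i k t) (Equiv.swap i k u)
      = momO μ j l r s t u := by
  obtain ⟨g, hg⟩ := exists_swapO i k
  have := integral_hh μ hH g _ (meas4 j l r s t u)
  simp only [hg] at this
  exact this

lemma momO_flip {n : ℕ} (μ : Measure (Matrix.orthogonalGroup (Fin n) ℝ))
    (hH : μ.IsHaarMeasure) (i j l r s t u : Fin n)
    (h : ((if r = i then -1 else 1) * (if s = i then -1 else 1) * (if t = i then -1 else 1) *
      (if u = i then -1 else 1) : ℝ) = -1) : momO μ j l r s t u = 0 := by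
  obtain ⟨g, hg⟩ := exists_flipO i
  have h2 := integral_hh μ hH g _ (meas4 j l r s t u)
  simp only [hg] at h2
  have h3 : ∀ O : Matrix.orthogonalGroup (Fin n) ℝ,
      (if r = i then -1 else 1) * entO O r j * ((if s = i then -1 else 1) * entO O s j) *
      ((if t = i then -1 else 1) * entO O t l * ((if u = i then -1 else 1) * entO O u l))
      = - (entO O r j * entO O s j * (entO O t l * entO O u l)) := by
    intro O
    have h4 := congrArg (fun z => z * (entO O r j * entO O s j * (entO O t l * entO O u l))) h
    simp only [neg_one_mul] at h4
    rw [← h4]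
    ring
  simp only [h3, integral_neg] at h2
  unfold momO
  linarith

lemma momO_rot {n : ℕ} (μ : Measure (Matrix.orthogonalGroup (Fin n) ℝ)) [IsProbabilityMeasure μ]
    (hH : μ.IsHaarMeasure) (i k j l : Fin n) (hik : i ≠ k) :
    momO μ j l i i i i = momO μ j l i i k k + 2 * momO μ j l i k i k := by
  obtain ⟨g, hg⟩ := exists_rotO i k hik
  have h2 := integral_hh μ hH g _ (meas4 j l i i i i)
  simp only [hg] at h2
  have I := int4 μ j l
  have hki := hik.symm
  have e1 : momO μ j l i i i k = 0 := momO_flip μ hH i _ _ _ _ _ _ (by simp [hki])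
  have e2 : momO μ j l i k i i = 0 := momO_flip μ hH i _ _ _ _ _ _ (by simp [hki])
  have e3 : momO μ j l k k i k = 0 := momO_flip μ hH i _ _ _ _ _ _ (by simp [hki])
  have e4 : momO μ j l i k k k = 0 := momO_flip μ hH i _ _ _ _ _ _ (by simp [hki])
  have e5 : momO μ j l k k k k = momO μ j l i i i i := by
    have := momO_swap μ hH i k j l i i i i
    simpa using this
  have e6 : momO μ j l k k i i = momO μ j l i i k k := by
    have := momO_swap μ hH i k j l i i k k
    simpa using this
  have h3 : ∀ O : Matrix.orthogonalGroup (Fin n) ℝ,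
      (3 / 5 * entO O i j + 4 / 5 * entO O k j) * (3 / 5 * entO O i j + 4 / 5 * entO O k j) *
      ((3 / 5 * entO O i l + 4 / 5 * entO O k l) * (3 / 5 * entO O i l + 4 / 5 * entO O k l))
      = 81 / 625 * (entO O i j * entO O i j * (entO O i l * entO O i l))
      + 216 / 625 * (entO O i j * entO O i j * (entO O i l * entO O k l))
      + 144 / 625 * (entO O i j * entO O i j * (entO O k l * entO O k l))
      + 216 / 625 * (entO O i j * entO O k j * (entO O i l * entO O i l))
      + 576 / 625 * (entO O i j * entO O k j * (entO O i l * entO O k l))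
      + 384 / 625 * (entO O i j * entO O k j * (entO O k l * entO O k l))
      + 144 / 625 * (entO O k j * entO O k j * (entO O i l * entO O i l))
      + 384 / 625 * (entO O k j * entO O k j * (entO O i l * entO O k l))
      + 256 / 625 * (entO O k j * entO O k j * (entO O k l * entO O k l)) := by
    intro O; ring
  simp only [h3] at h2
  have J := fun (a : ℝ) r s t u => (I r s t u).const_mul a
  rw [integral_add (by fun_prop) (by fun_prop), integral_add (by fun_prop) (by fun_prop),
    integral_add (by fun_prop) (by fun_prop), integral_add (by fun_prop) (by fun_prop),
    integral_add (by fun_prop) (by fun_prop), integral_add (by fun_prop) (by fun_prop),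
    integral_add (by fun_prop) (by fun_prop), integral_add (by fun_prop) (by fun_prop)] at h2
  simp only [integral_const_mul] at h2
  simp only [momO] at *
  rw [e1, e2, e3, e4, e5, e6] at h2
  linarith

lemma mom2 {n : ℕ} (μ : Measure (Matrix.orthogonalGroup (Fin n) ℝ)) [IsProbabilityMeasure μ]
    (hH : μ.IsHaarMeasure) (i j : Fin n) :
    ∫ O, entO O i j * entO O i j ∂μ = 1 / n := by
  have hs : ∀ k, ∫ O, entO O k j * entO O k j ∂μ = ∫ O, entO O i j * entO O i j ∂μ := by
    intro k
    obtain ⟨g, hg⟩ := exists_swapO i k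
    have := integral_hh μ hH g (fun O => entO O i j * entO O i j)
      ((measurable_entO _ _).mul (measurable_entO _ _))
    simpa [hg] using this
  have h : ∑ k, ∫ O, entO O k j * entO O k j ∂μ = 1 := by
    rw [← integral_finsetSum _ fun k _ => int2 μ k j]
    simp [entO_col]
  have hn : (n : ℝ) ≠ 0 := by
    have := i.pos
    positivity
  simp only [hs, Finset.sum_const, Finset.card_univ, Fintype.card_fin, nsmul_eq_mul] at h
  rw [eq_div_iff hn, mul_comm]
  exact h

lemma sum_b {n : ℕ} (μ : Measure (Matrix.orthogonalGroup (Fin n) ℝ)) [IsProbabilityMeasure μ]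
    (hH : μ.IsHaarMeasure) (i j l : Fin n) :
    ∑ k, momO μ j l i i k k = 1 / n := by
  unfold momO
  rw [← integral_finsetSum _ fun k _ => int4 μ j l i i k k]
  simp only [← Finset.mul_sum, entO_col, if_true, mul_one]
  exact mom2 μ hH i j

lemma sum_c {n : ℕ} (μ : Measure (Matrix.orthogonalGroup (Fin n) ℝ)) [IsProbabilityMeasure μ]
    (hH : μ.IsHaarMeasure) (i j l : Fin n) :
    ∑ k, momO μ j l i k i k = (if j = l then 1 else 0) / n := by
  unfold momO
  rw [← integral_finsetSum _ fun k _ => int4 μ j l i k i k]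
  have : ∀ O : Matrix.orthogonalGroup (Fin n) ℝ,
      ∑ k, entO O i j * entO O k j * (entO O i l * entO O k l) =
      entO O i j * entO O i l * (if j = l then 1 else 0) := by
    intro O
    rw [← entO_col O j l, Finset.mul_sum]
    exact Finset.sum_congr rfl fun _ _ => by ring
  simp only [this]
  rcases eq_or_ne j l with rfl | h
  · simpa using mom2 μ hH i j
  · simp [h]

lemma mom_a {n : ℕ} (μ : Measure (Matrix.orthogonalGroup (Fin n) ℝ)) [IsProbabilityMeasure μ]
    (hH : μ.IsHaarMeasure) (i j l : Fin n) :
    momO μ j l i i i i = (1 + 2 * (if j = l then 1 else 0)) / (n * (n + 2)) := by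
  have h1 := sum_b μ hH i j l
  have h2 := sum_c μ hH i j l
  rw [← Finset.add_sum_erase _ _ (Finset.mem_univ i)] at h1 h2
  have h3 : ∑ k ∈ Finset.univ.erase i, momO μ j l i i i i =
      ∑ k ∈ Finset.univ.erase i, (momO μ j l i i k k + 2 * momO μ j l i k i k) :=
    Finset.sum_congr rfl fun k hk => momO_rot μ hH i k j l (Finset.ne_of_mem_erase hk).symm
  rw [Finset.sum_add_distrib, ← Finset.mul_sum, Finset.sum_const,
    Finset.card_erase_of_mem (Finset.mem_univ i), Finset.card_univ, Fintype.card_fin,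
    nsmul_eq_mul, Nat.cast_sub (by have := i.pos; omega)] at h3
  push_cast at h3
  have hn : (0 : ℝ) < n := by exact_mod_cast i.pos
  generalize (if j = l then (1 : ℝ) else 0) = d at *
  have h4 : (n + 2) * momO μ j l i i i i = (1 + 2 * d) / n := by
    have : (1 + 2 * d) / n = 1 / n + 2 * (d / n) := by ring
    rw [this]
    linarith
  field_simp at h4 ⊢
  linarith

lemma mom_b {n : ℕ} (μ : Measure (Matrix.orthogonalGroup (Fin n) ℝ)) [IsProbabilityMeasure μ]
    (hH : μ.IsHaarMeasure) (hn : 2 ≤ n) (i k j l : Fin n) (hik : i ≠ k) :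
    momO μ j l i i k k =
      (1 / n - (1 + 2 * (if j = l then 1 else 0)) / (n * (n + 2))) / (n - 1) := by
  have h1 := sum_b μ hH i j l
  rw [← Finset.add_sum_erase _ _ (Finset.mem_univ i), mom_a μ hH] at h1
  have h3 : ∑ k' ∈ Finset.univ.erase i, momO μ j l i i k' k' =
      ∑ k' ∈ Finset.univ.erase i, momO μ j l i i k k := by
    refine Finset.sum_congr rfl fun k' hk => ?_
    have hk' := Finset.ne_of_mem_erase hk
    have := momO_swap μ hH k k' j l i i k k
    simpa [Equiv.swap_apply_of_ne_of_ne hik hk'.symm] using this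
  rw [h3, Finset.sum_const,
    Finset.card_erase_of_mem (Finset.mem_univ i), Finset.card_univ, Fintype.card_fin,
    nsmul_eq_mul, Nat.cast_sub (by omega)] at h1
  push_cast at h1
  have hn : (2 : ℝ) ≤ n := by exact_mod_cast hn
  rw [eq_div_iff (by linarith)]
  linarith

/-- initial index set -/
def iniO (n p : ℕ) : Finset (Fin n) := Finset.univ.filter fun i => (i : ℕ) < p

lemma card_iniO {n p : ℕ} (h : p ≤ n) : (iniO n p).card = p := by
  simp [iniO, Fin.card_filter_val_lt, h]

lemma trunc_eq (n p q : ℕ) (O : Matrix.orthogonalGroup (Fin n) ℝ) :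
    truncTraceO n p q O = ∑ i ∈ iniO n p, ∑ j ∈ iniO n q, entO O i j * entO O i j := by
  simp only [truncTraceO, iniO, Finset.sum_filter, entO, ite_and, pow_two]
  refine Finset.sum_congr rfl fun i _ => ?_
  split_ifs <;> simp

lemma mean_trunc {n p q : ℕ} (μ : Measure (Matrix.orthogonalGroup (Fin n) ℝ))
    [IsProbabilityMeasure μ] (hH : μ.IsHaarMeasure) (hp : p ≤ n) (hq : q ≤ n) :
    ∫ O, truncTraceO n p q O ∂μ = p * q / n := by
  simp only [trunc_eq]
  rw [integral_finsetSum _ fun i _ => integrable_finsetSum _ fun j _ => int2 μ i j]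
  have : ∀ i, ∫ O, ∑ j ∈ iniO n q, entO O i j * entO O i j ∂μ = q * (1 / n) := by
    intro i
    rw [integral_finsetSum _ fun j _ => int2 μ i j]
    simp [mom2 μ hH, card_iniO hq]
  simp only [this, Finset.sum_const, card_iniO hp, nsmul_eq_mul]
  ring

lemma sq_trunc (n p q : ℕ) (O : Matrix.orthogonalGroup (Fin n) ℝ) :
    truncTraceO n p q O ^ 2 = ∑ i ∈ iniO n p, ∑ k ∈ iniO n p, ∑ j ∈ iniO n q, ∑ l ∈ iniO n q,
      entO O i j * entO O i j * (entO O k l * entO O k l) := by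
  rw [trunc_eq, pow_two, Finset.sum_mul_sum]
  simp only [Finset.sum_mul_sum]

lemma sum_delta {n : ℕ} (S : Finset (Fin n)) (A B : ℝ) (f : Fin n → Fin n → ℝ)
    (hd : ∀ i, f i i = A) (ho : ∀ i k, i ≠ k → f i k = B) :
    ∑ i ∈ S, ∑ k ∈ S, f i k = S.card * A + S.card * (S.card - 1) * B := by
  have : ∀ i k, f i k = B + if i = k then A - B else 0 := by
    intro i k
    rcases eq_or_ne i k with rfl | h
    · simp [hd]
    · simp [ho i k h, h]
  simp only [this, Finset.sum_add_distrib, Finset.sum_ite_eq, Finset.sum_const, nsmul_eq_mul]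
  rw [Finset.sum_congr rfl fun i hi => if_pos hi]
  simp only [Finset.sum_const, nsmul_eq_mul]
  ring

lemma sqmean_trunc {n p q : ℕ} (μ : Measure (Matrix.orthogonalGroup (Fin n) ℝ))
    [IsProbabilityMeasure μ] (hH : μ.IsHaarMeasure) (hn : 2 ≤ n) (hp : p ≤ n) (hq : q ≤ n) :
    ∫ O, truncTraceO n p q O ^ 2 ∂μ = 
      p * (q * (3 / (n * (n + 2))) + q * (q - 1) * (1 / (n * (n + 2)))) +
      p * (p - 1) * (q * ((1 / n - 3 / (n * (n + 2))) / (n - 1)) +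
        q * (q - 1) * ((1 / n - 1 / (n * (n + 2))) / (n - 1))) := by
  simp only [sq_trunc]
  have I := fun i k j l => int4 μ j l i i k k
  rw [integral_finsetSum _ fun i _ => integrable_finsetSum _ fun k _ =>
    integrable_finsetSum _ fun j _ => integrable_finsetSum _ fun l _ => I i k j l]
  have e : ∀ i, ∫ O, ∑ k ∈ iniO n p, ∑ j ∈ iniO n q, ∑ l ∈ iniO n q,
      entO O i j * entO O i j * (entO O k l * entO O k l) ∂μ =
      ∑ k ∈ iniO n p, ∑ j ∈ iniO n q, ∑ l ∈ iniO n q, momO μ j l i i k k := by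
    intro i
    rw [integral_finsetSum _ fun k _ =>
      integrable_finsetSum _ fun j _ => integrable_finsetSum _ fun l _ => I i k j l]
    refine Finset.sum_congr rfl fun k _ => ?_
    rw [integral_finsetSum _ fun j _ => integrable_finsetSum _ fun l _ => I i k j l]
    refine Finset.sum_congr rfl fun j _ => ?_
    rw [integral_finsetSum _ fun l _ => I i k j l]
    rfl
  simp only [e]
  rw [sum_delta (iniO n p) _ _
    (fun i k => ∑ j ∈ iniO n q, ∑ l ∈ iniO n q, momO μ j l i i k k) ?_ ?_, card_iniO hp]
  · intro i
    rw [sum_delta (iniO n q) _ _ (fun j l => momO μ j l i i i i) ?_ ?_, card_iniO hq]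
    · intro j
      rw [mom_a μ hH]; norm_num
    · intro j l h
      rw [mom_a μ hH]; simp [h]
  · intro i k hik
    rw [sum_delta (iniO n q) _ _ (fun j l => momO μ j l i i k k) ?_ ?_, card_iniO hq]
    · intro j
      rw [mom_b μ hH hn _ _ _ _ hik]; norm_num
    · intro j l h
      rw [mom_b μ hH hn _ _ _ _ hik]; simp [h]

lemma var_trunc {n p q : ℕ} (μ : Measure (Matrix.orthogonalGroup (Fin n) ℝ))
    [IsProbabilityMeasure μ] (hH : μ.IsHaarMeasure) (hn : 2 ≤ n) (hp : p ≤ n) (hq : q ≤ n) :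
    variance (truncTraceO n p q) μ =
      2 * p * q * (n - p) * (n - q) / (n ^ 2 * (n - 1) * (n + 2)) := by
  have hm : Measurable (truncTraceO n p q) := by
    have : truncTraceO n p q = fun O => ∑ i ∈ iniO n p, ∑ j ∈ iniO n q, entO O i j * entO O i j :=
      funext fun O => trunc_eq n p q O
    rw [this]
    exact Finset.measurable_sum _ fun i _ => Finset.measurable_sum _ fun j _ =>
      (measurable_entO i j).mul (measurable_entO i j)
  have hL : MemLp (truncTraceO n p q) 2 μ := by
    rw [memLp_two_iff_integrable_sq hm.aestronglyMeasurable]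
    simp only [sq_trunc]
    exact integrable_finsetSum _ fun i _ => integrable_finsetSum _ fun k _ =>
      integrable_finsetSum _ fun j _ => integrable_finsetSum _ fun l _ => int4 μ j l i i k k
  rw [variance_eq_sub hL, mean_trunc μ hH hp hq]
  simp only [Pi.pow_apply]
  rw [sqmean_trunc μ hH hn hp hq]
  have hn' : (2 : ℝ) ≤ n := by exact_mod_cast hn
  have h1 : (n : ℝ) ≠ 0 := by linarith
  have h2 : (n : ℝ) - 1 ≠ 0 := by linarith
  have h3 : (n : ℝ) + 2 ≠ 0 := by linarith
  field_simp
  ring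

/-- If `O⁽ⁿ⁾` is Haar distributed on `O(n)`, and `p(n)/n → s`, `q(n)/n → t`
with `1 ≤ p(n), q(n) ≤ n` and `s, t ∈ [0,1]`, then `(1/n) E[T_{p(n),q(n)}] → st` and
`Var(T_{p(n),q(n)}) → 2st(1-s)(1-t)`. -/
theorem limit_mean_variance_truncTraceO
    (μ : ∀ n : ℕ, Measure (Matrix.orthogonalGroup (Fin n) ℝ))
    (hHaar : ∀ n, (μ n).IsHaarMeasure) (hProb : ∀ n, IsProbabilityMeasure (μ n))
    (p q : ℕ → ℕ)
    (hp : ∀ n, 2 ≤ n → 1 ≤ p n ∧ p n ≤ n) (hq : ∀ n, 2 ≤ n → 1 ≤ q n ∧ q n ≤ n)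
    (s t : ℝ) (hs : s ∈ Set.Icc (0 : ℝ) 1) (ht : t ∈ Set.Icc (0 : ℝ) 1)
    (hps : Tendsto (fun n : ℕ => (p n : ℝ) / n) atTop (nhds s))
    (hqt : Tendsto (fun n : ℕ => (q n : ℝ) / n) atTop (nhds t)) :
    Tendsto (fun n : ℕ => (1 / (n : ℝ)) * ∫ O, truncTraceO n (p n) (q n) O ∂(μ n))
      atTop (nhds (s * t)) ∧
    Tendsto (fun n : ℕ => variance (truncTraceO n (p n) (q n)) (μ n))
      atTop (nhds (2 * (s * t) * (1 - s) * (1 - t))) := by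
  have inv : Tendsto (fun n : ℕ => (1 : ℝ) / n) atTop (nhds 0) := tendsto_one_div_atTop_nhds_zero_nat
  constructor
  · refine (hps.mul hqt).congr' ?_
    filter_upwards [eventually_ge_atTop 2] with n hn
    haveI := hProb n
    rw [mean_trunc (μ n) (hHaar n) (hp n hn).2 (hq n hn).2]
    ring
  · have L : Tendsto (fun n : ℕ => 2 * ((p n : ℝ) / n * ((q n : ℝ) / n)) * (1 - (p n : ℝ) / n) *
        (1 - (q n : ℝ) / n) / ((1 - (1 : ℝ) / n) * (1 + 2 * ((1 : ℝ) / n)))) atTop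
        (nhds (2 * (s * t) * (1 - s) * (1 - t) / ((1 - 0) * (1 + 2 * 0)))) := by
      refine Tendsto.div ?_ ?_ (by norm_num)
      · exact (((hps.mul hqt).const_mul 2).mul (hps.const_sub 1)).mul (hqt.const_sub 1)
      · exact (inv.const_sub 1).mul ((inv.const_mul 2).const_add 1)
    have e : 2 * (s * t) * (1 - s) * (1 - t) / ((1 - 0) * (1 + 2 * 0)) =
        2 * (s * t) * (1 - s) * (1 - t) := by ring
    rw [e] at L
    refine L.congr' ?_
    filter_upwards [eventually_ge_atTop 2] with n hn
    haveI := hProb n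
    rw [var_trunc (μ n) (hHaar n) hn (hp n hn).2 (hq n hn).2]
    have hn' : (2 : ℝ) ≤ n := by exact_mod_cast hn
    have h1 : (n : ℝ) ≠ 0 := by linarith
    have h2 : (n : ℝ) - 1 ≠ 0 := by linarith
    have h3 : (n : ℝ) + 2 ≠ 0 := by linarith
    field_simp
end

section
/- There exists a constant C > 0 such that for every n ≥ 2 and all 1 ≤ p, q ≤ n, if O is distributed according to the Haar probability measure on the orthogonal group O(n) and T_{p,q} = Σ_{i≤p, j≤q} O_{ij}², then E[(T_{p,q} − pq/n)^4] ≤ C p² q² / n⁴. -/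
open MeasureTheory Matrix

namespace FMB

abbrev OG (n : ℕ) : Type := Matrix.orthogonalGroup (Fin n) ℝ

instance borelMat {n : ℕ} : BorelSpace (Matrix (Fin n) (Fin n) ℝ) :=
  inferInstanceAs (BorelSpace (Fin n → Fin n → ℝ))

instance secondMat {n : ℕ} : SecondCountableTopology (Matrix (Fin n) (Fin n) ℝ) :=
  inferInstanceAs (SecondCountableTopology (Fin n → Fin n → ℝ))

instance borelOG {n : ℕ} : BorelSpace (OG n) := Subtype.borelSpace _

instance secondOG {n : ℕ} : SecondCountableTopology (OG n) :=
  Topology.IsEmbedding.subtypeVal.secondCountableTopology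

instance compactOG {n : ℕ} : CompactSpace (OG n) := by
  have hcl : IsClosed ((Matrix.orthogonalGroup (Fin n) ℝ : Set (Matrix (Fin n) (Fin n) ℝ))) :=
    isClosed_unitary
  have hK : IsCompact (Set.univ.pi fun _ : Fin n => Set.univ.pi fun _ : Fin n =>
      Set.Icc (-1 : ℝ) 1) :=
    isCompact_univ_pi fun _ => isCompact_univ_pi fun _ => isCompact_Icc
  have : IsCompact ((Matrix.orthogonalGroup (Fin n) ℝ : Set (Matrix (Fin n) (Fin n) ℝ))) := by
    refine IsCompact.of_isClosed_subset hK hcl ?_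
    intro U hU i _ j _
    have := entry_norm_bound_of_unitary hU i j
    rw [Real.norm_eq_abs, abs_le] at this
    exact this
  exact isCompact_iff_compactSpace.mp this

lemma integ {n : ℕ} (μ : Measure (OG n)) [IsProbabilityMeasure μ] {f : OG n → ℝ}
    (hf : Continuous f) : Integrable f μ :=
  hf.integrable_of_hasCompactSupport (HasCompactSupport.of_compactSpace f)

/-- Consequences of invariance under plane rotations. -/
lemma moments {n : ℕ} (μ : Measure (OG n)) [IsProbabilityMeasure μ] {g u v : OG n → ℝ}
    (hg : Continuous g) (hu : Continuous u) (hv : Continuous v)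
    (h : ∀ x y : ℝ, x ^ 2 + y ^ 2 = 1 → ∀ k : ℕ,
      ∫ O, (g O - 2 * y ^ 2 * u O + 2 * x * y * v O) ^ k ∂μ = ∫ O, g O ^ k ∂μ) :
    ∫ O, u O ∂μ = 0 ∧ ∫ O, g O * u O ∂μ = ∫ O, v O ^ 2 ∂μ ∧
    ∫ O, g O ^ 3 * u O ∂μ = 3 * ∫ O, g O ^ 2 * v O ^ 2 ∂μ := by
  have h1 : ∫ O, u O ∂μ = 0 := by
    have := h 0 1 (by norm_num) 1
    simp only [pow_one, mul_zero, zero_mul, add_zero, one_pow, mul_one] at this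
    rw [integral_sub (integ μ (by fun_prop)) (integ μ (by fun_prop)), integral_const_mul] at this
    linarith
  refine ⟨h1, ?_, ?_⟩
  · have key : ∀ x y : ℝ, x ^ 2 + y ^ 2 = 1 →
        (2 * y ^ 2) * (∫ O, (-2 * g O * u O + 2 * v O ^ 2) ∂μ) +
        (2 * y ^ 2) ^ 2 * (∫ O, (u O ^ 2 - v O ^ 2) ∂μ) = 0 := by
      intro x y hxy
      have e1 := h x y hxy 2
      have e2 := h x (-y) (by linarith [neg_sq y]) 2
      have e3 : ∀ O, (g O - 2 * y ^ 2 * u O + 2 * x * y * v O) ^ 2 +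
          (g O - 2 * (-y) ^ 2 * u O + 2 * x * (-y) * v O) ^ 2 =
          2 * g O ^ 2 + (2 * (2 * y ^ 2)) * (-2 * g O * u O + 2 * v O ^ 2) +
            (2 * (2 * y ^ 2) ^ 2) * (u O ^ 2 - v O ^ 2) := by
        intro O
        have : x ^ 2 = 1 - y ^ 2 := by linarith
        ring_nf
        rw [this]
        ring
      have e4 := integral_congr_ae (μ := μ) (Filter.Eventually.of_forall e3)
      rw [integral_add (integ μ (by fun_prop)) (integ μ (by fun_prop)),
        integral_add (integ μ (by fun_prop)) (integ μ (by fun_prop)),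
        integral_add (integ μ (by fun_prop)) (integ μ (by fun_prop)),
        integral_const_mul, integral_const_mul, integral_const_mul, e1, e2] at e4
      linarith
    have k1 := key 0 1 (by norm_num)
    have k2 := key (3/5) (4/5) (by norm_num)
    norm_num only at k1 k2
    have k3 : ∫ O, (-2 * g O * u O + 2 * v O ^ 2) ∂μ = 0 := by linarith
    have k4 : ∀ O, -2 * g O * u O + 2 * v O ^ 2 = -2 * (g O * u O) + 2 * v O ^ 2 := by
      intro O; ring
    rw [integral_congr_ae (Filter.Eventually.of_forall k4),
      integral_add (integ μ (by fun_prop)) (integ μ (by fun_prop)),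
      integral_const_mul, integral_const_mul] at k3
    linarith
  · have key : ∀ x y : ℝ, x ^ 2 + y ^ 2 = 1 →
        (2 * y ^ 2) * (∫ O, (-4 * (g O ^ 3 * u O) + 12 * (g O ^ 2 * v O ^ 2)) ∂μ) +
        (2 * y ^ 2) ^ 2 * (∫ O, (6 * g O ^ 2 * u O ^ 2 - 6 * g O ^ 2 * v O ^ 2
          - 24 * g O * u O * v O ^ 2 + 4 * v O ^ 4) ∂μ) +
        (2 * y ^ 2) ^ 3 * (∫ O, (-4 * g O * u O ^ 3 + 12 * g O * u O * v O ^ 2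
          + 12 * u O ^ 2 * v O ^ 2 - 4 * v O ^ 4) ∂μ) +
        (2 * y ^ 2) ^ 4 * (∫ O, (u O ^ 4 - 6 * u O ^ 2 * v O ^ 2 + v O ^ 4) ∂μ) = 0 := by
      intro x y hxy
      have e1 := h x y hxy 4
      have e2 := h x (-y) (by linarith [neg_sq y]) 4
      have e3 : ∀ O, (g O - 2 * y ^ 2 * u O + 2 * x * y * v O) ^ 4 +
          (g O - 2 * (-y) ^ 2 * u O + 2 * x * (-y) * v O) ^ 4 =
          2 * g O ^ 4 + (2 * (2 * y ^ 2)) * (-4 * (g O ^ 3 * u O) + 12 * (g O ^ 2 * v O ^ 2)) +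
            (2 * (2 * y ^ 2) ^ 2) * (6 * g O ^ 2 * u O ^ 2 - 6 * g O ^ 2 * v O ^ 2
          - 24 * g O * u O * v O ^ 2 + 4 * v O ^ 4) +
            (2 * (2 * y ^ 2) ^ 3) * (-4 * g O * u O ^ 3 + 12 * g O * u O * v O ^ 2
          + 12 * u O ^ 2 * v O ^ 2 - 4 * v O ^ 4) +
            (2 * (2 * y ^ 2) ^ 4) * (u O ^ 4 - 6 * u O ^ 2 * v O ^ 2 + v O ^ 4) := by
        intro O
        have h2 : x ^ 2 = 1 - y ^ 2 := by linarith
        have h4 : x ^ 4 = (1 - y ^ 2) ^ 2 := by rw [← h2]; ring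
        ring_nf
        rw [h2, h4]
        ring
      have e4 := integral_congr_ae (μ := μ) (Filter.Eventually.of_forall e3)
      rw [integral_add (integ μ (by fun_prop)) (integ μ (by fun_prop)),
        integral_add (integ μ (by fun_prop)) (integ μ (by fun_prop)),
        integral_add (integ μ (by fun_prop)) (integ μ (by fun_prop)),
        integral_add (integ μ (by fun_prop)) (integ μ (by fun_prop)),
        integral_add (integ μ (by fun_prop)) (integ μ (by fun_prop)),
        integral_const_mul, integral_const_mul, integral_const_mul, integral_const_mul,
        integral_const_mul, e1, e2] at e4
      linarith
    have k1 := key 0 1 (by norm_num)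
    have k2 := key (3/5) (4/5) (by norm_num)
    have k3 := key (4/5) (3/5) (by norm_num)
    have k4 := key (12/13) (5/13) (by norm_num)
    norm_num only at k1 k2 k3 k4
    have k5 : ∫ O, (-4 * (g O ^ 3 * u O) + 12 * (g O ^ 2 * v O ^ 2)) ∂μ = 0 := by linarith
    rw [integral_add (integ μ (by fun_prop)) (integ μ (by fun_prop)),
      integral_const_mul, integral_const_mul] at k5
    linarith

/-- Rows of the rotation in the plane of coordinates `a, b`. -/
def row {n : ℕ} (a b : Fin n) (x y : ℝ) (i : Fin n) : Fin n → ℝ :=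
  if i = a then Pi.single a x + Pi.single b y
    else if i = b then Pi.single a (-y) + Pi.single b x else Pi.single i 1

/-- Rotation in the plane of coordinates `a, b`. -/
def rot {n : ℕ} (a b : Fin n) (x y : ℝ) : Matrix (Fin n) (Fin n) ℝ :=
  Matrix.of (row a b x y)

lemma rot_mem {n : ℕ} {a b : Fin n} (hab : a ≠ b) {x y : ℝ} (h : x ^ 2 + y ^ 2 = 1) :
    rot a b x y ∈ Matrix.orthogonalGroup (Fin n) ℝ := by
  rw [Matrix.mem_orthogonalGroup_iff]
  ext i j
  change row a b x y i ⬝ᵥ row a b x y j = _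
  have hba := hab.symm
  by_cases hia : i = a
  · by_cases hja : j = a
    · subst hia; subst hja
      simp [row, hab, hba]; linarith
    · by_cases hjb : j = b
      · subst hia; subst hjb
        simp [row, hab, hba]; ring
      · subst hia
        simp [row, hja, hjb, Ne.symm hja, Ne.symm hjb]
  · by_cases hib : i = b
    · by_cases hja : j = a
      · subst hib; subst hja
        simp [row, hab, hba]; ring
      · by_cases hjb : j = b
        · subst hib; subst hjb
          simp [row, hab, hba]; linarith
        · subst hib
          simp [row, hja, hjb, hia, Ne.symm hja, Ne.symm hjb]
    · by_cases hja : j = a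
      · subst hja
        simp [row, hia, hib, Ne.symm hia, Ne.symm hib]
      · by_cases hjb : j = b
        · subst hjb
          simp [row, hia, hib, hja, Ne.symm hia, Ne.symm hib]
        · simp [row, hia, hib, hja, hjb, Matrix.one_apply, Pi.single_apply, eq_comm]

def M {n : ℕ} (B : Finset (Fin n)) (O : OG n) (i j : Fin n) : ℝ :=
  ∑ k ∈ B, (O : Matrix (Fin n) (Fin n) ℝ) i k * (O : Matrix (Fin n) (Fin n) ℝ) j k

lemma M_cont {n : ℕ} (B : Finset (Fin n)) (i j : Fin n) : Continuous fun O => M B O i j := by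
  unfold M
  exact continuous_finsetSum _ fun k _ =>
    (continuous_subtype_val.matrix_elem i k).mul (continuous_subtype_val.matrix_elem j k)

lemma M_symm {n : ℕ} (B : Finset (Fin n)) (O : OG n) (i j : Fin n) : M B O i j = M B O j i := by
  unfold M
  exact Finset.sum_congr rfl fun k _ => mul_comm _ _

lemma col_orth {n : ℕ} (O : OG n) (k l : Fin n) :
    ∑ b, (O : Matrix (Fin n) (Fin n) ℝ) b k * (O : Matrix (Fin n) (Fin n) ℝ) b l =
      if k = l then 1 else 0 := by
  have h := (Matrix.mem_orthogonalGroup_iff' (Fin n) ℝ).1 O.2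
  have := congrFun (congrFun h k) l
  rw [Matrix.one_apply] at this
  rw [← this]
  rfl

lemma M_sq {n : ℕ} (B : Finset (Fin n)) (O : OG n) (a : Fin n) :
    ∑ b, M B O a b ^ 2 = M B O a a := by
  unfold M
  have : ∀ b, (∑ k ∈ B, (O : Matrix (Fin n) (Fin n) ℝ) a k * (O : Matrix (Fin n) (Fin n) ℝ) b k) ^ 2
      = ∑ k ∈ B, ∑ l ∈ B, (O.1 a k * O.1 a l) * (O.1 b k * O.1 b l) := by
    intro b
    rw [sq, Finset.sum_mul_sum]
    exact Finset.sum_congr rfl fun k _ => Finset.sum_congr rfl fun l _ => by ring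
  simp_rw [this]
  rw [Finset.sum_comm]
  refine Finset.sum_congr rfl fun k hk => ?_
  rw [Finset.sum_comm]
  simp_rw [← Finset.mul_sum, col_orth]
  simp [hk]

lemma M_trace {n : ℕ} (B : Finset (Fin n)) (O : OG n) : ∑ a, M B O a a = B.card := by
  unfold M
  rw [Finset.sum_comm]
  simp_rw [col_orth]
  simp

lemma M_rot {n : ℕ} (B A : Finset (Fin n)) {a b : Fin n} (ha : a ∈ A) (hb : b ∉ A) {x y : ℝ}
    (h : x ^ 2 + y ^ 2 = 1) (hR : rot a b x y ∈ Matrix.orthogonalGroup (Fin n) ℝ) (O : OG n) :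
    ∑ i ∈ A, M B ((⟨rot a b x y, hR⟩ : OG n) * O) i i =
      ∑ i ∈ A, M B O i i - 2 * y ^ 2 * ((M B O a a - M B O b b) / 2) + 2 * x * y * M B O a b := by
  have hx : x ^ 2 = 1 - y ^ 2 := by linarith
  rw [← Finset.add_sum_erase A _ ha, ← Finset.add_sum_erase A (fun i => M B O i i) ha]
  have e1 : ∀ i ∈ A.erase a, M B ((⟨rot a b x y, hR⟩ : OG n) * O) i i = M B O i i := by
    intro i hi
    have hia : i ≠ a := Finset.ne_of_mem_erase hi
    have hib : i ≠ b := by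
      rintro rfl
      exact hb (Finset.mem_of_mem_erase hi)
    have : ∀ k, (((⟨rot a b x y, hR⟩ : OG n) * O : OG n) : Matrix (Fin n) (Fin n) ℝ) i k =
        O.1 i k := by
      intro k
      change row a b x y i ⬝ᵥ (fun j => O.1 j k) = _
      simp [row, hia, hib]
    unfold M
    simp_rw [this]
  rw [Finset.sum_congr rfl e1]
  have e2 : ∀ k, (((⟨rot a b x y, hR⟩ : OG n) * O : OG n) : Matrix (Fin n) (Fin n) ℝ) a k =
        x * O.1 a k + y * O.1 b k := by
    intro k
    change row a b x y a ⬝ᵥ (fun j => O.1 j k) = _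
    simp [row]
  have e3 : M B ((⟨rot a b x y, hR⟩ : OG n) * O) a a =
      x ^ 2 * M B O a a + 2 * x * y * M B O a b + y ^ 2 * M B O b b := by
    unfold M
    simp_rw [e2]
    simp_rw [Finset.mul_sum, ← Finset.sum_add_distrib]
    exact Finset.sum_congr rfl fun k _ => by ring
  rw [e3, hx]
  ring

lemma sum_pairs {n : ℕ} (A : Finset (Fin n)) (f : Fin n → ℝ) :
    ∑ a ∈ A, ∑ b ∈ Aᶜ, (f a - f b) / 2 =
      (n * ∑ a ∈ A, f a - A.card * ∑ a, f a) / 2 := by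
  have h1 : (Aᶜ.card : ℝ) = n - A.card := by
    rw [Finset.card_compl, Fintype.card_fin, Nat.cast_sub]
    simpa using Finset.card_le_univ A
  have h2 := Finset.sum_add_sum_compl A f
  simp_rw [← Finset.sum_div, Finset.sum_sub_distrib, Finset.sum_const, nsmul_eq_mul,
    ← Finset.mul_sum, h1, ← h2]
  ring

theorem main {n : ℕ} (hn : 2 ≤ n) (A B : Finset (Fin n)) (hA : 1 ≤ A.card) (hB : 1 ≤ B.card)
    (μ : Measure (OG n)) [μ.IsHaarMeasure] [IsProbabilityMeasure μ] :
    ∫ O, (∑ i ∈ A, M B O i i - (A.card : ℝ) * B.card / n) ^ 4 ∂μ ≤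
      96 * (A.card : ℝ) ^ 2 * (B.card : ℝ) ^ 2 / (n : ℝ) ^ 4 := by
  have hn0 : (0 : ℝ) < n := by positivity
  set m : ℝ := (A.card : ℝ) * B.card / n with hm
  set g : OG n → ℝ := fun O => ∑ i ∈ A, M B O i i - m with hgdef
  have hMc := M_cont B
  have hg : Continuous g := by fun_prop
  have hpair : ∀ a ∈ A, ∀ b ∈ Aᶜ,
      ∫ O, (M B O a a - M B O b b) / 2 ∂μ = 0 ∧
      ∫ O, g O * ((M B O a a - M B O b b) / 2) ∂μ = ∫ O, M B O a b ^ 2 ∂μ ∧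
      ∫ O, g O ^ 3 * ((M B O a a - M B O b b) / 2) ∂μ =
        3 * ∫ O, g O ^ 2 * M B O a b ^ 2 ∂μ := by
    intro a ha b hb
    rw [Finset.mem_compl] at hb
    refine moments μ hg (by fun_prop) (by fun_prop) ?_
    intro x y hxy k
    have hab : a ≠ b := by rintro rfl; exact hb ha
    have hR := rot_mem hab hxy
    rw [← integral_mul_left_eq_self (fun O => g O ^ k) (⟨rot a b x y, hR⟩ : OG n)]
    refine integral_congr_ae (Filter.Eventually.of_forall fun O => ?_)
    simp only [hgdef]
    rw [M_rot B A ha hb hxy hR]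
    ring
  have hsum : ∀ O, ∑ a ∈ A, ∑ b ∈ Aᶜ, (M B O a a - M B O b b) / 2 = n / 2 * g O := by
    intro O
    rw [sum_pairs A (fun i => M B O i i), M_trace]
    simp only [hgdef, hm]
    field_simp
  have hV : ∀ O, ∑ a ∈ A, ∑ b ∈ Aᶜ, M B O a b ^ 2 ≤ g O + m := by
    intro O
    simp only [hgdef, sub_add_cancel]
    refine Finset.sum_le_sum fun a _ => ?_
    rw [← M_sq]
    exact Finset.sum_le_sum_of_subset_of_nonneg (Finset.subset_univ _) fun _ _ _ => sq_nonneg _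
  -- generic summation
  have hS : ∀ (F : OG n → ℝ) (G : Fin n → Fin n → OG n → ℝ), Continuous F →
      (∀ a b, Continuous (G a b)) →
      ∑ a ∈ A, ∑ b ∈ Aᶜ, ∫ O, F O * G a b O ∂μ = ∫ O, F O * ∑ a ∈ A, ∑ b ∈ Aᶜ, G a b O ∂μ := by
    intro F G hF hG
    simp_rw [Finset.mul_sum]
    rw [integral_finsetSum _ fun a _ => integ μ (by fun_prop)]
    refine Finset.sum_congr rfl fun a _ => ?_
    rw [integral_finsetSum _ fun b _ => integ μ (by fun_prop)]
  have E1 : ∫ O, g O ∂μ = 0 := by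
    have := hS (fun _ => 1) (fun a b O => (M B O a a - M B O b b) / 2) (by fun_prop)
      (fun a b => by fun_prop)
    simp only [one_mul, hsum] at this
    rw [integral_const_mul, Finset.sum_eq_zero fun a ha =>
      Finset.sum_eq_zero fun b hb => (hpair a ha b hb).1] at this
    have h2 : (n : ℝ) / 2 ≠ 0 := by positivity
    exact (mul_eq_zero.1 this.symm).resolve_left h2
  have E2 : ∫ O, g O ^ 2 ∂μ ≤ 2 * m / n := by
    have h1 := hS g (fun a b O => (M B O a a - M B O b b) / 2) hg (fun a b => by fun_prop)
    have h2 := hS (fun _ => 1) (fun a b O => M B O a b ^ 2) (by fun_prop) (fun a b => by fun_prop)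
    simp only [one_mul] at h2
    rw [Finset.sum_congr rfl fun a ha => Finset.sum_congr rfl fun b hb => (hpair a ha b hb).2.1,
      h2] at h1
    have h3 : ∫ O, ∑ a ∈ A, ∑ b ∈ Aᶜ, M B O a b ^ 2 ∂μ ≤ ∫ O, (g O + m) ∂μ :=
      integral_mono (integ μ (by fun_prop)) (integ μ (by fun_prop)) hV
    rw [h1, integral_add (integ μ hg) (integ μ (by fun_prop)), E1] at h3
    have h4 : ∀ O, g O * ∑ a ∈ A, ∑ b ∈ Aᶜ, (M B O a a - M B O b b) / 2 = n / 2 * g O ^ 2 := by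
      intro O; rw [hsum]; ring
    simp_rw [h4] at h3
    rw [integral_const_mul] at h3
    simp at h3
    rw [le_div_iff₀ hn0]
    linarith
  have E4 : n / 2 * ∫ O, g O ^ 4 ∂μ ≤ 3 * ∫ O, g O ^ 2 * (g O + m) ∂μ := by
    have h1 := hS (fun O => g O ^ 3) (fun a b O => (M B O a a - M B O b b) / 2) (by fun_prop)
      (fun a b => by fun_prop)
    have h2 := hS (fun O => g O ^ 2) (fun a b O => M B O a b ^ 2) (by fun_prop)
      (fun a b => by fun_prop)
    rw [Finset.sum_congr rfl fun a ha => Finset.sum_congr rfl fun b hb => (hpair a ha b hb).2.2]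
      at h1
    simp only [← Finset.mul_sum A, ← Finset.mul_sum Aᶜ] at h1
    rw [h2] at h1
    have h3 : ∫ O, g O ^ 2 * ∑ a ∈ A, ∑ b ∈ Aᶜ, M B O a b ^ 2 ∂μ ≤ ∫ O, g O ^ 2 * (g O + m) ∂μ :=
      integral_mono (integ μ (by fun_prop)) (integ μ (by fun_prop))
        fun O => mul_le_mul_of_nonneg_left (hV O) (sq_nonneg _)
    have h4 : ∀ O, g O ^ 3 * ∑ a ∈ A, ∑ b ∈ Aᶜ, (M B O a a - M B O b b) / 2 = n / 2 * g O ^ 4 := by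
      intro O; rw [hsum]; ring
    rw [integral_congr_ae (Filter.Eventually.of_forall h4), integral_const_mul] at h1
    linarith
  have E5 : ∫ O, g O ^ 2 * (g O + m) ∂μ ≤
      n / 12 * ∫ O, g O ^ 4 ∂μ + (3 / n + m) * ∫ O, g O ^ 2 ∂μ := by
    rw [← integral_const_mul, ← integral_const_mul,
      ← integral_add (integ μ (by fun_prop)) (integ μ (by fun_prop))]
    refine integral_mono (integ μ (by fun_prop)) (integ μ (by fun_prop)) fun O => ?_
    have : n / 12 * g O ^ 4 + (3 / n + m) * g O ^ 2 - g O ^ 2 * (g O + m) =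
        g O ^ 2 * (n * g O - 6) ^ 2 / (12 * n) := by
      field_simp
      ring
    have h0 : 0 ≤ g O ^ 2 * (n * g O - 6) ^ 2 / (12 * n) := by positivity
    simp only
    linarith
  have hm1 : 1 / n ≤ m := by
    rw [hm]
    gcongr
    exact_mod_cast Nat.mul_le_mul hA hB
  have hm0 : 0 ≤ m := by positivity
  have E6 : (3 / n + m) * ∫ O, g O ^ 2 ∂μ ≤ (4 * m) * (2 * m / n) := by
    have : 3 / n + m ≤ 4 * m := by
      have : 3 / (n : ℝ) = 3 * (1 / n) := by ring
      linarith
    refine mul_le_mul this E2 (integral_nonneg fun O => sq_nonneg _) (by positivity)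
  have E7 : (n : ℝ) * ∫ O, g O ^ 4 ∂μ ≤ 96 * m ^ 2 / n := by
    have : 96 * m ^ 2 / n = 12 * ((4 * m) * (2 * m / n)) := by ring
    linarith
  have E8 : 96 * (A.card : ℝ) ^ 2 * (B.card : ℝ) ^ 2 / (n : ℝ) ^ 4 = (96 * m ^ 2 / n) / n := by
    rw [hm]; field_simp
  rw [E8, le_div_iff₀ hn0, mul_comm]
  exact E7

end FMB

/-- There is a constant `C > 0` such that for every `n ≥ 2`, all
`1 ≤ p, q ≤ n` and `O` Haar distributed on the orthogonal group `O(n)`,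
`E[(T_{p,q} - pq/n)⁴] ≤ C p² q² / n⁴`. -/
theorem fourth_moment_bound_truncTraceO :
    ∃ C : ℝ, 0 < C ∧ ∀ n : ℕ, 2 ≤ n → ∀ p q : ℕ, 1 ≤ p → p ≤ n → 1 ≤ q → q ≤ n →
      ∀ μ : Measure (Matrix.orthogonalGroup (Fin n) ℝ),
        μ.IsHaarMeasure → IsProbabilityMeasure μ →
        ∫ O, (truncTraceO n p q O - (p : ℝ) * q / n) ^ 4 ∂μ ≤
          C * p ^ 2 * q ^ 2 / (n : ℝ) ^ 4 := by
  refine ⟨96, by norm_num, ?_⟩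
  intro n hn p q hp hpn hq hqn μ hμ hμ'
  have hcard : ∀ r : ℕ, r ≤ n → (Finset.univ.filter fun i : Fin n => (i : ℕ) < r).card = r := by
    intro r hr
    rw [Fin.card_filter_val_lt]
    exact min_eq_right hr
  have h := FMB.main hn (Finset.univ.filter fun i : Fin n => (i : ℕ) < p)
    (Finset.univ.filter fun i : Fin n => (i : ℕ) < q)
    (by rw [hcard p hpn]; exact hp) (by rw [hcard q hqn]; exact hq) μ
  rw [hcard p hpn, hcard q hqn] at h
  have e : ∀ O, truncTraceO n p q O =
      ∑ i ∈ Finset.univ.filter (fun i : Fin n => (i : ℕ) < p),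
        FMB.M (Finset.univ.filter fun i : Fin n => (i : ℕ) < q) O i i := by
    intro O
    unfold truncTraceO FMB.M
    rw [Finset.sum_filter]
    refine Finset.sum_congr rfl fun i _ => ?_
    by_cases hi : (i : ℕ) < p
    · simp [hi, Finset.sum_filter, sq]
    · simp [hi]
  simp_rw [e]
  exact h
end
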